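/- arXiv:2101.05583 — 5 statements merged into one kernel-verified Lean document; each statement's English description precedes it below -/
import Mathlib

section
/- For every τ in the complex upper half-plane ℍ one has η(τ) = θ_{6,1}(τ;0) − θ_{6,5}(τ;0); explicitly, e^{πiτ/12} · ∏_{n=1}^∞ (1 − e^{2πinτ}) = Σ_{n ∈ ℤ, n ≡ 1 (mod 12)} e^{2πi n² τ/24} − Σ_{n ∈ ℤ, n ≡ 5 (mod 12)} e^{2πi n² τ/24}, all series and products converging absolutely. -/
open Complex Real

/-- The Dedekind eta function `η(τ) = e^{πiτ/12} ∏_{n=1}^∞ (1 − e^{2πinτ})`. -/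
noncomputable def dedekindEta (τ : ℂ) : ℂ :=
  Complex.exp (Real.pi * Complex.I * τ / 12) *
    ∏' n : ℕ, (1 - Complex.exp (2 * Real.pi * Complex.I * (n + 1) * τ))

/-- Sum a function on the integers over the even and the odd integers separately. -/
theorem HasSum.int_even_add_odd {M : Type*} [AddCommMonoid M] [TopologicalSpace M]
    [ContinuousAdd M] {f : ℤ → M} {a b : M} (ha : HasSum (f ∘ fun m : ℤ ↦ 2 * m) a)
    (hb : HasSum (f ∘ fun m : ℤ ↦ 2 * m + 1) b) : HasSum f (a + b) := by
  have hinj_even : Function.Injective fun m : ℤ ↦ 2 * m := fun a b h ↦ by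
    simp only at h; lia
  have hinj_odd : Function.Injective fun m : ℤ ↦ 2 * m + 1 := fun a b h ↦ by
    simp only at h; lia
  have heven : Set.range (fun m : ℤ ↦ 2 * m) = {n | Even n} := by
    ext n; simp [even_iff_exists_two_mul]
  have hodd : Set.range (fun m : ℤ ↦ 2 * m + 1) = {n | Odd n} := by
    ext n; simp [Odd]
  refine HasSum.add_isCompl (s := Set.range fun m : ℤ ↦ 2 * m)
    (t := Set.range fun m : ℤ ↦ 2 * m + 1) ?_ ?_ ?_
  · rw [heven, hodd]
    exact Int.isCompl_even_odd
  · exact hinj_even.hasSum_range_iff.2 ha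
  · exact hinj_odd.hasSum_range_iff.2 hb

open Filter Topology in
/-- Euler's pentagonal number theorem at a complex number `q` with `‖q‖ < 1`. -/
theorem hasSum_negOnePow_mul_pow_pentagonal {q : ℂ} (hq : ‖q‖ < 1) :
    HasSum (fun k : ℤ ↦ (k.negOnePow : ℂ) * q ^ pentagonal k) (∏' n : ℕ, (1 - q ^ (n + 1))) := by
  have hsummable : Summable fun k : ℤ ↦ (k.negOnePow : ℂ) * q ^ pentagonal k := by
    refine .of_norm ?_
    have h (k : ℤ) : ‖(k.negOnePow : ℂ)‖ = 1 := by
      rcases Int.even_or_odd k with hk | hk <;>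
        simp [Int.negOnePow_even, Int.negOnePow_odd, hk]
    simpa [h, Function.comp_def] using
      (summable_geometric_of_lt_one (norm_nonneg q) hq).comp_injective pentagonal_injective
  have hnat : HasSum (fun k : ℕ ↦ (-1) ^ k * (q ^ pentagonal (-k) - q ^ pentagonal (k + 1)))
      (∑' k : ℤ, (k.negOnePow : ℂ) * q ^ pentagonal k) := by
    have h := hsummable.hasSum
    rw [← neg_injective.hasSum_iff (fun x hx ↦ absurd ⟨-x, neg_neg x⟩ hx)] at h
    convert h.nat_add_neg_add_one using 2 with k
    simp_rw [Function.comp_apply, neg_neg, Int.negOnePow_add]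
    simp
    ring
  obtain ⟨C, hC⟩ : ∃ C : ℝ, ∀ k n : ℕ,
      ‖∏ i ∈ Finset.range (n + 1), (1 - q ^ (k + i + 1))‖ ≤ C := by
    refine ⟨Real.exp (∑' i : ℕ, ‖q‖ ^ i), fun k n ↦ ?_⟩
    rw [norm_prod]
    calc ∏ i ∈ Finset.range (n + 1), ‖1 - q ^ (k + i + 1)‖
        ≤ ∏ i ∈ Finset.range (n + 1), (1 + ‖q‖ ^ i) := by
          refine Finset.prod_le_prod (fun _ _ ↦ norm_nonneg _) fun i _ ↦ ?_
          refine (norm_sub_le _ _).trans ?_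
          rw [norm_one, norm_pow]
          gcongr 1 + ?_
          exact pow_le_pow_of_le_one (norm_nonneg q) hq.le (by lia)
      _ ≤ Real.exp (∑ i ∈ Finset.range (n + 1), ‖q‖ ^ i) :=
          Real.prod_one_add_le_exp_sum _ fun i ↦ by positivity
      _ ≤ _ := by
          gcongr
          exact (summable_geometric_of_lt_one (norm_nonneg q) hq).sum_le_tsum _
            fun i _ ↦ by positivity
  have hC0 : 0 ≤ C := (norm_nonneg _).trans (hC 0 0)
  have hbound (k n : ℕ) :
      ‖q ^ ((k + 1) * n) * ∏ i ∈ Finset.range (n + 1), (1 - q ^ (k + i + 1))‖ ≤ ‖q‖ ^ n * C := by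
    rw [norm_mul, norm_pow]
    refine mul_le_mul (pow_le_pow_of_le_one (norm_nonneg q) hq.le (by nlinarith)) (hC k n)
      (norm_nonneg _) (by positivity)
  have hgeom : Summable fun n : ℕ ↦ ‖q‖ ^ n * C :=
    (summable_geometric_of_lt_one (norm_nonneg q) hq).mul_right C
  have hprod (k : ℕ) : Multipliable fun n : ℕ ↦ 1 - q ^ (n + k + 1) := by
    simp_rw [sub_eq_add_neg]
    refine multipliable_one_add_of_summable ?_
    simpa [add_assoc] using (summable_nat_add_iff (k + 1)).2
      (summable_geometric_of_lt_one (norm_nonneg q) hq)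
  have hpent := Pentagonal.tprod_one_sub_pow (x := q)
    (tendsto_pow_atTop_nhds_zero_of_norm_lt_one hq)
    (fun k ↦ .of_norm_bounded hgeom (hbound k)) hprod hnat.summable ?_
  · rw [hpent, hnat.tsum_eq]
    exact hsummable.hasSum
  · refine squeeze_zero_norm (a := fun k : ℕ ↦ ‖q‖ ^ k * ∑' n : ℕ, ‖q‖ ^ n * C) (fun k ↦ ?_) ?_
    · rw [norm_mul, norm_mul, norm_pow, norm_neg, norm_one, one_pow, one_mul, norm_pow]
      refine mul_le_mul (pow_le_pow_of_le_one (norm_nonneg q) hq.le ?_)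
        (tsum_of_norm_bounded hgeom.hasSum (hbound k)) (norm_nonneg _) (by positivity)
      rw [Nat.le_div_iff_mul_le two_pos]
      nlinarith
    · simpa using (tendsto_pow_atTop_nhds_zero_of_lt_one (norm_nonneg q) hq).mul_const
        (∑' n : ℕ, ‖q‖ ^ n * C)

/-- `η(τ) = θ_{6,1}(τ;0) − θ_{6,5}(τ;0)` for `τ` in the upper half-plane, all series
and products converging absolutely. -/
theorem eta_eq_theta_six_one_sub_theta_six_five (τ : ℂ) (hτ : 0 < τ.im) :
    Multipliable (fun n : ℕ => 1 - Complex.exp (2 * Real.pi * Complex.I * (n + 1) * τ)) ∧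
    Summable (fun n : ℤ =>
      if (n : ZMod 12) = 1 then Complex.exp (2 * Real.pi * Complex.I * (n : ℂ) ^ 2 * τ / 24)
      else 0) ∧
    Summable (fun n : ℤ =>
      if (n : ZMod 12) = 5 then Complex.exp (2 * Real.pi * Complex.I * (n : ℂ) ^ 2 * τ / 24)
      else 0) ∧
    dedekindEta τ =
      (∑' n : ℤ,
        if (n : ZMod 12) = 1 then Complex.exp (2 * Real.pi * Complex.I * (n : ℂ) ^ 2 * τ / 24)
        else 0) -
      (∑' n : ℤ,
        if (n : ZMod 12) = 5 then Complex.exp (2 * Real.pi * Complex.I * (n : ℂ) ^ 2 * τ / 24)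
        else 0) := by
  set q : ℂ := Complex.exp (2 * Real.pi * Complex.I * τ) with hqdef
  have hq : ‖q‖ < 1 := by
    rw [hqdef, Complex.norm_exp, Real.exp_lt_one_iff]
    have : 0 < 2 * Real.pi * τ.im := by positivity
    simpa using this
  have hpow (n : ℕ) : Complex.exp (2 * Real.pi * Complex.I * (n + 1) * τ) = q ^ (n + 1) := by
    rw [hqdef, ← Complex.exp_nat_mul]
    push_cast
    ring_nf
  have hterm (k : ℤ) : Complex.exp (2 * Real.pi * Complex.I * (1 - 6 * k) ^ 2 * τ / 24) =
      Complex.exp (Real.pi * Complex.I * τ / 12) * q ^ pentagonal k := by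
    rw [hqdef, ← Complex.exp_nat_mul, ← Complex.exp_add]
    have h : 2 * (pentagonal k : ℂ) = k * (3 * k - 1) := by
      exact_mod_cast two_mul_natCast_pentagonal k
    congr 1
    linear_combination -(Real.pi * Complex.I * τ) * h
  have hsum := hasSum_negOnePow_mul_pow_pentagonal hq
  have hinj1 : Function.Injective fun m : ℤ ↦ 1 - 12 * m := fun a b h ↦ by
    simp only at h; lia
  have hinj5 : Function.Injective fun m : ℤ ↦ 12 * m + 5 := fun a b h ↦ by
    simp only at h; lia
  have hinj_even : Function.Injective fun m : ℤ ↦ 2 * m := fun a b h ↦ by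
    simp only at h; lia
  have hinj_odd : Function.Injective fun m : ℤ ↦ 2 * m + 1 := fun a b h ↦ by
    simp only at h; lia
  obtain ⟨A, hA⟩ := hsum.summable.comp_injective hinj_even
  obtain ⟨B, hB⟩ := hsum.summable.comp_injective hinj_odd
  have hsplit : (∏' n : ℕ, (1 - q ^ (n + 1))) = A + B :=
    hsum.unique (hA.int_even_add_odd hB)
  have htheta1 : HasSum (fun n : ℤ ↦ if (n : ZMod 12) = 1 then
      Complex.exp (2 * Real.pi * Complex.I * (n : ℂ) ^ 2 * τ / 24) else 0)
      (Complex.exp (Real.pi * Complex.I * τ / 12) * A) := by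
    rw [← hinj1.hasSum_iff]
    · refine (hA.mul_left (Complex.exp (Real.pi * Complex.I * τ / 12))).congr_fun fun m ↦ ?_
      have h12 : (12 : ZMod 12) = 0 := rfl
      have h := hterm (2 * m)
      simp only [Function.comp_apply, Int.negOnePow_two_mul]
      push_cast at h ⊢
      rw [if_pos (by simp [h12]), one_mul, ← h]
      ring_nf
    · refine fun n hn ↦ if_neg fun h ↦ hn ?_
      obtain ⟨c, hc⟩ := (ZMod.intCast_eq_intCast_iff_dvd_sub n 1 12).1 (by simpa using h)
      exact ⟨c, by push_cast at hc; simp only; lia⟩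
  have htheta5 : HasSum (fun n : ℤ ↦ if (n : ZMod 12) = 5 then
      Complex.exp (2 * Real.pi * Complex.I * (n : ℂ) ^ 2 * τ / 24) else 0)
      (-Complex.exp (Real.pi * Complex.I * τ / 12) * B) := by
    rw [← hinj5.hasSum_iff]
    · refine (hB.mul_left (-Complex.exp (Real.pi * Complex.I * τ / 12))).congr_fun fun m ↦ ?_
      have h12 : (12 : ZMod 12) = 0 := rfl
      have h := hterm (2 * m + 1)
      simp only [Function.comp_apply, Int.negOnePow_two_mul_add_one]
      push_cast at h ⊢
      rw [if_pos (by simp [h12]), neg_one_mul, neg_mul_neg, ← h]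
      ring_nf
    · refine fun n hn ↦ if_neg fun h ↦ hn ?_
      obtain ⟨c, hc⟩ := (ZMod.intCast_eq_intCast_iff_dvd_sub 5 n 12).1 (by simpa using h.symm)
      exact ⟨c, by push_cast at hc; simp only; lia⟩
  refine ⟨?_, htheta1.summable, htheta5.summable, ?_⟩
  · simp_rw [hpow]
    exact ModularForm.multipliable_one_sub_pow hq
  · rw [htheta1.tsum_eq, htheta5.tsum_eq, dedekindEta]
    simp_rw [hpow]
    rw [hsplit]
    ring
end

section
/- For every τ in the complex upper half-plane ℍ one has η(τ)³ = θ_{2,1}(τ;1); explicitly, (e^{πiτ/12} · ∏_{n=1}^∞ (1 − e^{2πinτ}))³ = Σ_{n ∈ ℤ, n ≡ 1 (mod 4)} n · e^{2πi n² τ/8}, the series converging absolutely. -/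
open Complex Real

/-- The finite Euler product `∏_{i=1}^n (1 − q^i)`. -/
noncomputable def eulerProd (q : ℂ) (n : ℕ) : ℂ := ∏ i ∈ Finset.range n, (1 - q ^ (i + 1))

/-- The Gaussian binomial coefficient, through the `q`-Pascal recursion. -/
noncomputable def gaussBinom (q : ℂ) : ℕ → ℕ → ℂ
  | _, 0 => 1
  | 0, _ + 1 => 0
  | n + 1, k + 1 => q ^ (k + 1) * gaussBinom q n (k + 1) + gaussBinom q n k

lemma gaussBinom_zero_right (q : ℂ) (n : ℕ) : gaussBinom q n 0 = 1 := by
  cases n <;> rfl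

lemma gaussBinom_succ_succ (q : ℂ) (n k : ℕ) :
    gaussBinom q (n + 1) (k + 1) = q ^ (k + 1) * gaussBinom q n (k + 1) + gaussBinom q n k := rfl

lemma gaussBinom_eq_zero_of_lt (q : ℂ) {n k : ℕ} (h : n < k) : gaussBinom q n k = 0 := by
  induction n generalizing k with
  | zero => obtain ⟨k, rfl⟩ := Nat.exists_eq_succ_of_ne_zero h.ne'; rfl
  | succ n ih =>
    obtain ⟨k, rfl⟩ := Nat.exists_eq_succ_of_ne_zero (by omega : k ≠ 0)
    rw [Nat.succ_eq_add_one, gaussBinom_succ_succ, ih (by omega), ih (by omega)]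
    ring

lemma gaussBinom_self (q : ℂ) (n : ℕ) : gaussBinom q n n = 1 := by
  induction n with
  | zero => rfl
  | succ n ih => rw [gaussBinom_succ_succ, ih, gaussBinom_eq_zero_of_lt q (by omega)]; ring

lemma eulerProd_zero (q : ℂ) : eulerProd q 0 = 1 := by simp [eulerProd]

lemma eulerProd_succ (q : ℂ) (n : ℕ) :
    eulerProd q (n + 1) = eulerProd q n * (1 - q ^ (n + 1)) := by
  simp [eulerProd, Finset.prod_range_succ]

/-- The product formula for Gaussian binomial coefficients. -/
lemma gaussBinom_add_mul (q : ℂ) (a b : ℕ) :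
    gaussBinom q (a + b) a * (eulerProd q a * eulerProd q b) = eulerProd q (a + b) := by
  induction a generalizing b with
  | zero => simp [gaussBinom_zero_right, eulerProd_zero]
  | succ a iha =>
    induction b with
    | zero => simp [gaussBinom_self, eulerProd_zero]
    | succ b ihb =>
      have h := iha (b + 1)
      rw [show a + 1 + (b + 1) = (a + 1 + b) + 1 by ring, gaussBinom_succ_succ]
      rw [show a + (b + 1) = a + 1 + b by ring] at h
      rw [eulerProd_succ q (a + 1 + b)]
      rw [eulerProd_succ q b] at h ⊢
      rw [eulerProd_succ q a] at ihb ⊢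
      linear_combination q ^ (a + 1) * (1 - q ^ (b + 1)) * ihb + (1 - q ^ (a + 1)) * h

/-- The `q`-binomial theorem. -/
lemma prod_one_add_mul_pow (q x : ℂ) (n : ℕ) :
    ∏ i ∈ Finset.range n, (1 + x * q ^ i) =
      ∑ k ∈ Finset.range (n + 1), q ^ k.choose 2 * gaussBinom q n k * x ^ k := by
  induction n generalizing x with
  | zero => simp [gaussBinom_zero_right]
  | succ n ih =>
    have hprod : ∏ i ∈ Finset.range (n + 1), (1 + x * q ^ i) =
        (1 + x) * ∏ i ∈ Finset.range n, (1 + (x * q) * q ^ i) := by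
      rw [Finset.prod_range_succ', mul_comm]
      simp [pow_succ', mul_assoc]
    have hsplit : ∑ k ∈ Finset.range (n + 1), q ^ k.choose 2 * gaussBinom q n k * (x * q) ^ k =
        ∑ k ∈ Finset.range (n + 1),
          q ^ (k + 1).choose 2 * gaussBinom q n (k + 1) * (x * q) ^ (k + 1) + 1 := by
      have h := Finset.sum_range_succ'
        (fun k ↦ q ^ k.choose 2 * gaussBinom q n k * (x * q) ^ k) (n + 1)
      rw [Finset.sum_range_succ, gaussBinom_eq_zero_of_lt q (Nat.lt_succ_self n)] at h
      simpa [gaussBinom_zero_right] using h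
    rw [hprod, ih, add_mul, one_mul, Finset.sum_range_succ' _ (n + 1)]
    nth_rewrite 1 [hsplit]
    rw [Finset.mul_sum, add_right_comm, ← Finset.sum_add_distrib]
    simp only [gaussBinom_zero_right, Nat.choose_zero_succ, pow_zero, mul_one]
    congr 1
    refine Finset.sum_congr rfl fun k _ ↦ ?_
    rw [gaussBinom_succ_succ, Nat.choose_succ_succ' k 1, Nat.choose_one_right]
    ring

/-- The derivative of the `q`-binomial theorem at the root of the factor `1 + x q^m`. -/
lemma sum_mul_gaussBinom_of_root (q x : ℂ) (n m : ℕ) (hx : x * q ^ m = -1) :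
    ∑ k ∈ Finset.range (m + 1 + n + 1), k * (q ^ k.choose 2 * gaussBinom q (m + 1 + n) k * x ^ k) =
      -((∏ i ∈ Finset.range m, (1 + x * q ^ i)) *
        ∏ i ∈ Finset.range n, (1 + x * q ^ (m + 1 + i))) := by
  set N := m + 1 + n with hN
  let g : ℂ → ℂ := fun y ↦ (∏ i ∈ Finset.range m, (1 + y * q ^ i)) *
        ∏ i ∈ Finset.range n, (1 + y * q ^ (m + 1 + i))
  have hg : DifferentiableAt ℂ g x := by
    apply DifferentiableAt.mul <;> exact DifferentiableAt.fun_finsetProd fun _ _ ↦ by fun_prop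
  have hfun : (fun y ↦ g y * (1 + y * q ^ m)) =
      fun y ↦ ∑ k ∈ Finset.range (N + 1), q ^ k.choose 2 * gaussBinom q N k * y ^ k := by
    funext y
    rw [← prod_one_add_mul_pow, hN, Finset.prod_range_add, Finset.prod_range_succ]
    simp only [g]
    ring
  have h1 : HasDerivAt (fun y ↦ g y * (1 + y * q ^ m))
      (deriv g x * (1 + x * q ^ m) + g x * (1 * q ^ m)) x :=
    hg.hasDerivAt.mul (((hasDerivAt_id x).mul_const _).const_add 1)
  have h2 : HasDerivAt
      (fun y ↦ ∑ k ∈ Finset.range (N + 1), q ^ k.choose 2 * gaussBinom q N k * y ^ k)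
      (∑ k ∈ Finset.range (N + 1), q ^ k.choose 2 * gaussBinom q N k * (k * x ^ (k - 1))) x :=
    HasDerivAt.fun_sum fun k _ ↦ (hasDerivAt_pow k x).const_mul _
  rw [hfun] at h1
  have h := h2.unique h1
  have hmul : ∑ k ∈ Finset.range (N + 1), k * (q ^ k.choose 2 * gaussBinom q N k * x ^ k) =
      x * ∑ k ∈ Finset.range (N + 1), q ^ k.choose 2 * gaussBinom q N k * (k * x ^ (k - 1)) := by
    rw [Finset.mul_sum]
    refine Finset.sum_congr rfl fun k _ ↦ ?_
    rcases k with _ | k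
    · simp
    · rw [Nat.add_sub_cancel]; ring
  rw [hmul, h]
  change _ = - g x
  linear_combination (x * deriv g x + g x) * hx

lemma pow_choose_mul_prod_one_sub_inv_pow {q : ℂ} (hq : q ≠ 0) (n : ℕ) :
    q ^ (n + 1).choose 2 * ∏ i ∈ Finset.range n, (1 + -(q⁻¹) ^ n * q ^ i) =
      (-1) ^ n * eulerProd q n := by
  have h : ∏ i ∈ Finset.range n, (1 + -(q⁻¹) ^ n * q ^ i) =
      ∏ i ∈ Finset.range n, (1 - (q⁻¹) ^ (i + 1)) := by
    rw [← Finset.prod_range_reflect]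
    refine Finset.prod_congr rfl fun i hi ↦ ?_
    obtain ⟨m, rfl⟩ := Nat.exists_eq_add_of_lt (Finset.mem_range.mp hi)
    rw [show i + m + 1 - 1 - i = m by omega]
    have : (q⁻¹) ^ m * q ^ m = 1 := by rw [← mul_pow, inv_mul_cancel₀ hq, one_pow]
    linear_combination -(q⁻¹) ^ (i + 1) * this
  rw [h]
  clear h
  induction n with
  | zero => simp [eulerProd]
  | succ n ih =>
    rw [Finset.prod_range_succ, eulerProd_succ, Nat.choose_succ_succ' (n + 1) 1,
      Nat.choose_one_right]
    have : (q⁻¹) ^ (n + 1) * q ^ (n + 1) = 1 := by rw [← mul_pow, inv_mul_cancel₀ hq, one_pow]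
    linear_combination (q ^ (n + 1) - 1) * ih -
      q ^ (n + 1).choose 2 * (∏ i ∈ Finset.range n, (1 - (q⁻¹) ^ (i + 1))) * this

lemma pow_mul_inv_pow_eq {q : ℂ} (hq : q ≠ 0) {a b c : ℕ} (h : a = c + b) :
    q ^ a * (q⁻¹) ^ b = q ^ c := by
  rw [h, pow_add, mul_assoc, ← mul_pow, mul_inv_cancel₀ hq, one_pow, mul_one]

/-- The finite form of Jacobi's identity for the cube of the Euler product. -/
lemma sum_mul_gaussBinom_eq_eulerProd_sq {q : ℂ} (hq : q ≠ 0) (n : ℕ) :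
    ∑ j ∈ Finset.range (n + 1), (-1) ^ j * q ^ (j + 1).choose 2 *
      ((n + 1 + j : ℕ) * gaussBinom q (2 * n + 1) (n + 1 + j) -
        (n - j : ℕ) * gaussBinom q (2 * n + 1) (n - j)) = eulerProd q n ^ 2 := by
  have hinv : (q⁻¹) ^ n * q ^ n = 1 := by rw [← mul_pow, inv_mul_cancel₀ hq, one_pow]
  have h := sum_mul_gaussBinom_of_root q (-(q⁻¹) ^ n) n n (by linear_combination -hinv)
  have hr : ∏ i ∈ Finset.range n, (1 + -(q⁻¹) ^ n * q ^ (n + 1 + i)) = eulerProd q n := by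
    refine Finset.prod_congr rfl fun i _ ↦ ?_
    linear_combination -q ^ (i + 1) * hinv
  rw [hr, show n + 1 + n = 2 * n + 1 by ring, show 2 * n + 1 + 1 = (n + 1) + (n + 1) by ring,
    Finset.sum_range_add, ← Finset.sum_range_reflect, ← Finset.sum_add_distrib] at h
  have hp := pow_choose_mul_prod_one_sub_inv_pow hq n
  have hsq : ((-1 : ℂ) ^ n) * (-1) ^ n = 1 := by rw [← mul_pow]; simp
  have key : eulerProd q n ^ 2 = -(-1) ^ n * q ^ (n + 1).choose 2 *
      -((∏ i ∈ Finset.range n, (1 + -(q⁻¹) ^ n * q ^ i)) * eulerProd q n) := by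
    linear_combination -(-1) ^ n * eulerProd q n * hp - eulerProd q n ^ 2 * hsq
  rw [key, ← h, Finset.mul_sum]
  refine Finset.sum_congr rfl fun j hj ↦ ?_
  obtain ⟨m, rfl⟩ := Nat.exists_eq_add_of_le (Nat.lt_succ_iff.mp (Finset.mem_range.mp hj))
  rw [show j + m + 1 - 1 - j = m by omega, show j + m - j = m by omega]
  have e1 : q ^ ((j + m + 1).choose 2 + m.choose 2) * (q⁻¹) ^ ((j + m) * m) =
      q ^ (j + 1).choose 2 := by
    apply pow_mul_inv_pow_eq hq
    have : (((j + m + 1).choose 2 + m.choose 2 : ℕ) : ℚ) =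
        (((j + 1).choose 2 + (j + m) * m : ℕ) : ℚ) := by
      push_cast [Nat.cast_choose_two]; ring
    exact_mod_cast this
  have e2 : q ^ ((j + m + 1).choose 2 + (j + m + 1 + j).choose 2) *
      (q⁻¹) ^ ((j + m) * (j + m + 1 + j)) = q ^ (j + 1).choose 2 := by
    apply pow_mul_inv_pow_eq hq
    have : (((j + m + 1).choose 2 + (j + m + 1 + j).choose 2 : ℕ) : ℚ) =
        (((j + 1).choose 2 + (j + m) * (j + m + 1 + j) : ℕ) : ℚ) := by
      push_cast [Nat.cast_choose_two]; ring
    exact_mod_cast this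
  rw [mul_sub, neg_pow _ m, neg_pow _ (j + m + 1 + j), ← pow_mul, ← pow_mul]
  nth_rewrite 1 [← e2]
  rw [← e1]
  have s1 : (-1 : ℂ) ^ (j + m) * (-1) ^ m = (-1) ^ j := by
    rw [pow_add, mul_assoc, ← mul_pow]; simp
  have s2 : (-1 : ℂ) ^ (j + m) * (-1) ^ (j + m + 1 + j) = -(-1) ^ j := by
    rw [add_assoc _ 1 j, pow_add _ (j + m) (1 + j), ← mul_assoc, ← mul_pow]; simp [pow_add]
  rw [pow_add q, pow_add q, mul_add]
  set A := (q⁻¹) ^ ((j + m) * m)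
  set B := (q⁻¹) ^ ((j + m) * (j + m + 1 + j))
  generalize (-1 : ℂ) ^ (j + m + 1 + j) = u at *
  generalize (-1 : ℂ) ^ (j + m) = v at *
  generalize (-1 : ℂ) ^ j = w at *
  generalize (-1 : ℂ) ^ m = t at *
  linear_combination (-(q ^ (j + m + 1).choose 2 * q ^ (j + m + 1 + j).choose 2 * B *
    (j + m + 1 + j : ℕ) * gaussBinom q (2 * (j + m) + 1) (j + m + 1 + j))) * (-s2) +
    (q ^ (j + m + 1).choose 2 * q ^ m.choose 2 * A * m * gaussBinom q (2 * (j + m) + 1) m) * s1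

lemma one_sub_pow_succ_ne_zero {q : ℂ} (hq : ‖q‖ < 1) (n : ℕ) : 1 - q ^ (n + 1) ≠ 0 := by
  intro h
  have h' : ‖q ^ (n + 1)‖ = 1 := by rw [← sub_eq_zero.mp h, norm_one]
  rw [norm_pow] at h'
  exact (pow_lt_one₀ (norm_nonneg q) hq n.succ_ne_zero).ne h'

lemma eulerProd_ne_zero {q : ℂ} (hq : ‖q‖ < 1) (n : ℕ) : eulerProd q n ≠ 0 :=
  Finset.prod_ne_zero_iff.mpr fun i _ ↦ one_sub_pow_succ_ne_zero hq i

lemma tprod_one_sub_pow_succ_ne_zero {q : ℂ} (hq : ‖q‖ < 1) : ∏' n : ℕ, (1 - q ^ (n + 1)) ≠ 0 := by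
  simp only [sub_eq_add_neg]
  refine tprod_one_add_ne_zero_of_summable (f := fun n ↦ -q ^ (n + 1)) (fun n ↦ ?_) ?_
  · simpa [sub_eq_add_neg] using one_sub_pow_succ_ne_zero hq n
  · simpa using (summable_nat_add_iff 1).mpr (summable_geometric_of_lt_one (norm_nonneg _) hq)

lemma tendsto_eulerProd {q : ℂ} (hq : ‖q‖ < 1) :
    Filter.Tendsto (eulerProd q) Filter.atTop (nhds (∏' n : ℕ, (1 - q ^ (n + 1)))) :=
  (ModularForm.multipliable_one_sub_pow hq).hasProd.tendsto_prod_nat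

lemma gaussBinom_eq_div {q : ℂ} (hq : ‖q‖ < 1) (a b : ℕ) :
    gaussBinom q (a + b) a = eulerProd q (a + b) * (eulerProd q a)⁻¹ * (eulerProd q b)⁻¹ := by
  have ha := eulerProd_ne_zero hq a
  have hb := eulerProd_ne_zero hq b
  rw [← gaussBinom_add_mul]
  field_simp

lemma sum_mul_eulerProd_quotient {q : ℂ} (hq0 : q ≠ 0) (hq : ‖q‖ < 1) (n : ℕ) :
    ∑ j ∈ Finset.range (n + 1), (-1) ^ j * (2 * j + 1) * q ^ (j + 1).choose 2 *
      (eulerProd q (2 * n + 1) * (eulerProd q (n - j))⁻¹ * (eulerProd q (n + 1 + j))⁻¹) =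
      eulerProd q n ^ 2 := by
  rw [← sum_mul_gaussBinom_eq_eulerProd_sq hq0]
  refine Finset.sum_congr rfl fun j hj ↦ ?_
  obtain ⟨m, rfl⟩ := Nat.exists_eq_add_of_le (Nat.lt_succ_iff.mp (Finset.mem_range.mp hj))
  rw [show j + m - j = m by omega]
  have h1 := gaussBinom_eq_div hq m (j + m + 1 + j)
  have h2 := gaussBinom_eq_div hq (j + m + 1 + j) m
  rw [show m + (j + m + 1 + j) = 2 * (j + m) + 1 by ring] at h1
  rw [show j + m + 1 + j + m = 2 * (j + m) + 1 by ring] at h2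
  rw [h1, h2]
  push_cast
  ring

lemma summable_jacobi_cube {q : ℂ} (hq : ‖q‖ < 1) :
    Summable fun j : ℕ ↦ ‖(-1) ^ j * (2 * j + 1) * q ^ (j + 1).choose 2‖ := by
  have h0 := summable_geometric_of_lt_one (norm_nonneg q) hq
  have h1 := summable_pow_mul_geometric_of_norm_lt_one (R := ℝ) 1 (r := ‖q‖) (by simpa using hq)
  refine Summable.of_nonneg_of_le (fun _ ↦ norm_nonneg _) (fun j ↦ ?_) ((h1.mul_left 2).add h0)
  have hj : j ≤ (j + 1).choose 2 := by
    rw [Nat.choose_succ_succ' j 1, Nat.choose_one_right]; omega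
  have h2 : ‖(2 * j + 1 : ℂ)‖ = 2 * j + 1 := by
    have := Complex.norm_natCast (2 * j + 1)
    push_cast at this
    exact this
  rw [norm_mul, norm_mul, norm_pow, norm_neg, norm_one, one_pow, one_mul, h2, norm_pow]
  calc (2 * j + 1 : ℝ) * ‖q‖ ^ (j + 1).choose 2 ≤ (2 * j + 1) * ‖q‖ ^ j := by
        gcongr ?_ * ?_
        exact pow_le_pow_of_le_one (norm_nonneg q) hq.le hj
    _ = _ := by ring

/-- Jacobi's identity `∏ (1 − qⁿ)³ = ∑ (−1)ʲ (2j+1) q^{j(j+1)/2}`. -/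
lemma tsum_jacobi_cube {q : ℂ} (hq0 : q ≠ 0) (hq : ‖q‖ < 1) :
    ∑' j : ℕ, (-1) ^ j * (2 * j + 1) * q ^ (j + 1).choose 2 =
      (∏' n : ℕ, (1 - q ^ (n + 1))) ^ 3 := by
  set L := ∏' n : ℕ, (1 - q ^ (n + 1)) with hL
  have hL0 : L ≠ 0 := tprod_one_sub_pow_succ_ne_zero hq
  have hP : Filter.Tendsto (eulerProd q) Filter.atTop (nhds L) := tendsto_eulerProd hq
  have hPinv := hP.inv₀ hL0
  obtain ⟨C, hC⟩ := hP.norm.bddAbove_range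
  obtain ⟨D, hD⟩ := hPinv.norm.bddAbove_range
  have hC' (n) : ‖eulerProd q n‖ ≤ C := hC ⟨n, rfl⟩
  have hD' (n) : ‖(eulerProd q n)⁻¹‖ ≤ D := hD ⟨n, rfl⟩
  have hC0 : 0 ≤ C := (norm_nonneg _).trans (hC' 0)
  have hD0 : 0 ≤ D := (norm_nonneg _).trans (hD' 0)
  let a : ℕ → ℂ := fun j ↦ (-1) ^ j * (2 * j + 1) * q ^ (j + 1).choose 2
  let f : ℕ → ℕ → ℂ := fun n j ↦ if j ∈ Finset.range (n + 1) then
    a j * (eulerProd q (2 * n + 1) * (eulerProd q (n - j))⁻¹ * (eulerProd q (n + 1 + j))⁻¹) else 0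
  have hf (n) : ∑' j, f n j = eulerProd q n ^ 2 := by
    rw [← sum_mul_eulerProd_quotient hq0 hq, tsum_eq_sum (s := Finset.range (n + 1))]
    · exact Finset.sum_congr rfl fun j hj ↦ if_pos hj
    · exact fun j hj ↦ if_neg hj
  have hlim : Filter.Tendsto (fun n ↦ ∑' j, f n j) Filter.atTop
      (nhds (∑' j, a j * (L * L⁻¹ * L⁻¹))) := by
    refine tendsto_tsum_of_dominated_convergence (bound := fun j ↦ ‖a j‖ * (C * D * D))
      ((summable_jacobi_cube hq).mul_right _) (fun j ↦ ?_) (.of_forall fun n j ↦ ?_)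
    · have t1 : Filter.Tendsto (fun n ↦ 2 * n + 1) Filter.atTop Filter.atTop :=
        Filter.tendsto_atTop_mono (fun n ↦ by simp only [id]; omega) Filter.tendsto_id
      have t2 : Filter.Tendsto (fun n ↦ n + 1 + j) Filter.atTop Filter.atTop :=
        Filter.tendsto_atTop_mono (fun n ↦ by simp only [id]; omega) Filter.tendsto_id
      refine ((((hP.comp t1).mul (hPinv.comp (Filter.tendsto_sub_atTop_nat j))).mul
        (hPinv.comp t2)).const_mul (a j)).congr' ?_
      filter_upwards [Filter.eventually_ge_atTop j] with n hn
      exact (if_pos (Finset.mem_range.mpr (by omega))).symm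
    · by_cases hj : j ∈ Finset.range (n + 1)
      · simp only [f, if_pos hj, norm_mul (a j), norm_mul _ (eulerProd q (n + 1 + j))⁻¹,
          norm_mul _ (eulerProd q (n - j))⁻¹]
        gcongr
        exacts [hC' _, hD' _, hD' _]
      · simp only [f, if_neg hj, norm_zero]
        positivity
  simp only [hf] at hlim
  have h := tendsto_nhds_unique hlim (hP.pow 2)
  rw [tsum_mul_right, mul_inv_cancel₀ hL0, one_mul] at h
  change ∑' j, a j = _
  field_simp at h
  rw [h]

lemma injective_neg_one_pow_mul : Function.Injective fun j : ℕ ↦ (-1 : ℤ) ^ j * (2 * j + 1) := by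
  intro a b h
  have h' := congrArg Int.natAbs h
  simp only [Int.natAbs_mul, Int.natAbs_pow, Int.natAbs_neg, Int.natAbs_one, one_pow, one_mul] at h'
  omega

lemma exists_neg_one_pow_mul_eq {n : ℤ} (hn : (n : ZMod 4) = 1) :
    ∃ j : ℕ, (-1 : ℤ) ^ j * (2 * j + 1) = n := by
  have h : n ≡ 1 [ZMOD 4] := (ZMod.intCast_eq_intCast_iff n 1 4).mp (by simpa using hn)
  have h4 : n % 4 = 1 := h
  rcases le_or_gt 0 n with h0 | h0
  · refine ⟨2 * (n / 4).toNat, ?_⟩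
    rw [pow_mul]
    push_cast
    rw [Int.toNat_of_nonneg (by omega)]
    simp
    omega
  · refine ⟨2 * (-n / 4).toNat + 1, ?_⟩
    rw [pow_succ, pow_mul]
    push_cast
    rw [Int.toNat_of_nonneg (by omega)]
    simp
    omega

lemma intCast_neg_one_pow_mul_zmod_four (j : ℕ) :
    (((-1 : ℤ) ^ j * (2 * j + 1) : ℤ) : ZMod 4) = 1 := by
  have : ((-1 : ℤ) ^ j * (2 * j + 1)) ≡ 1 [ZMOD 4] := by
    rcases Nat.even_or_odd' j with ⟨k, rfl | rfl⟩
    · rw [pow_mul]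
      simp [Int.ModEq]
      omega
    · rw [pow_succ, pow_mul]
      simp [Int.ModEq]
      omega
  simpa using (ZMod.intCast_eq_intCast_iff _ 1 4).mpr this

/-- `η(τ)³ = θ_{2,1}(τ;1)` for `τ` in the upper half-plane: explicitly
`(e^{πiτ/12} ∏_{n≥1}(1 − e^{2πinτ}))³ = Σ_{n ≡ 1 (mod 4)} n e^{2πi n² τ/8}`,
the series converging absolutely. -/
theorem eta_cubed_eq_theta_two_one (τ : ℂ) (hτ : 0 < τ.im) :
    Summable (fun n : ℤ =>
      if (n : ZMod 4) = 1 then (n : ℂ) * Complex.exp (2 * Real.pi * Complex.I * (n : ℂ) ^ 2 * τ / 8)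
      else 0) ∧
    (dedekindEta τ) ^ 3 =
      ∑' n : ℤ,
        if (n : ZMod 4) = 1 then
          (n : ℂ) * Complex.exp (2 * Real.pi * Complex.I * (n : ℂ) ^ 2 * τ / 8)
        else 0 := by
  set q := Complex.exp (2 * Real.pi * Complex.I * τ) with hq
  have hq0 : q ≠ 0 := Complex.exp_ne_zero _
  have hq1 : ‖q‖ < 1 := UpperHalfPlane.norm_exp_two_pi_I_lt_one ⟨τ, hτ⟩
  set F : ℤ → ℂ := fun n ↦ if (n : ZMod 4) = 1 then
    (n : ℂ) * Complex.exp (2 * Real.pi * Complex.I * (n : ℂ) ^ 2 * τ / 8) else 0 with hF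
  have hcomp : F ∘ (fun j : ℕ ↦ (-1 : ℤ) ^ j * (2 * j + 1)) = fun j : ℕ ↦
      Complex.exp (Real.pi * Complex.I * τ / 4) *
        ((-1) ^ j * (2 * j + 1) * q ^ (j + 1).choose 2) := by
    funext j
    have hexp : Complex.exp (2 * Real.pi * Complex.I *
        (((-1 : ℤ) ^ j * (2 * j + 1) : ℤ) : ℂ) ^ 2 * τ / 8) =
        Complex.exp (Real.pi * Complex.I * τ / 4) * q ^ (j + 1).choose 2 := by
      rw [hq, ← Complex.exp_nat_mul, ← Complex.exp_add]
      congr 1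
      push_cast [Nat.cast_choose_two]
      rw [mul_pow, ← pow_mul, mul_comm j 2, pow_mul]
      ring
    simp only [hF, Function.comp_apply, if_pos (intCast_neg_one_pow_mul_zmod_four j), hexp]
    push_cast
    ring
  have hsum : HasSum F (Complex.exp (Real.pi * Complex.I * τ / 4) *
      (∏' n : ℕ, (1 - q ^ (n + 1))) ^ 3) := by
    rw [← injective_neg_one_pow_mul.hasSum_iff, hcomp, ← tsum_jacobi_cube hq0 hq1]
    · exact (summable_jacobi_cube hq1).of_norm.hasSum.mul_left _
    · exact fun n hn ↦ if_neg fun h ↦ hn (exists_neg_one_pow_mul_eq h)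
  refine ⟨hsum.summable, ?_⟩
  have hprod : ∏' n : ℕ, (1 - Complex.exp (2 * Real.pi * Complex.I * (n + 1) * τ)) =
      ∏' n : ℕ, (1 - q ^ (n + 1)) := by
    refine tprod_congr fun n ↦ ?_
    rw [hq, ← Complex.exp_nat_mul]
    push_cast
    ring_nf
  rw [hsum.tsum_eq, dedekindEta, hprod, mul_pow, ← Complex.exp_nat_mul]
  congr 2
  push_cast
  ring
end

section
/- (Weber's identity, stated in Lemma 2.2 of the paper.) For every τ in the complex upper half-plane ℍ one has η(τ)² = θ_{3,0}(τ;0)·θ_{3,1}(τ;0) − θ_{3,2}(τ;0)·θ_{3,3}(τ;0); explicitly, (e^{πiτ/12} ∏_{n=1}^∞ (1 − e^{2πinτ}))² = (Σ_{n ≡ 0 (mod 6)} e^{2πi n² τ/12})(Σ_{n ≡ 1 (mod 6)} e^{2πi n² τ/12}) − (Σ_{n ≡ 2 (mod 6)} e^{2πi n² τ/12})(Σ_{n ≡ 3 (mod 6)} e^{2πi n² τ/12}), where each sum ranges over all n ∈ ℤ in the indicated residue class. -/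
open Complex Real

/-- The unary theta component `θ_{3,h}(τ;0) = Σ_{n ≡ h (mod 6)} e^{2πi n² τ/12}`,
as a function of the residue class `h` modulo `6`. -/
noncomputable def thetaThree (h : ZMod 6) (τ : ℂ) : ℂ :=
  ∑' n : ℤ, if (n : ZMod 6) = h then Complex.exp (2 * Real.pi * Complex.I * (n : ℂ) ^ 2 * τ / 12)
    else 0

open Filter Topology

theorem norm_prod_one_sub_pow_le {x : ℂ} (hx : ‖x‖ < 1) (k n : ℕ) :
    ‖∏ i ∈ Finset.range n, (1 - x ^ (k + i + 1))‖ ≤ Real.exp (1 - ‖x‖)⁻¹ := by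
  have hpow (i : ℕ) : ‖x‖ ^ (k + i + 1) ≤ ‖x‖ ^ i :=
    pow_le_pow_of_le_one (norm_nonneg _) hx.le (by lia)
  calc ‖∏ i ∈ Finset.range n, (1 - x ^ (k + i + 1))‖
      ≤ ∏ i ∈ Finset.range n, Real.exp (‖x‖ ^ i) := by
        rw [norm_prod]
        refine Finset.prod_le_prod (fun _ _ ↦ norm_nonneg _) fun i _ ↦ ?_
        calc ‖1 - x ^ (k + i + 1)‖ ≤ 1 + ‖x‖ ^ (k + i + 1) := by
              simpa using norm_sub_le (1 : ℂ) (x ^ (k + i + 1))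
          _ ≤ ‖x‖ ^ i + 1 := by linarith [hpow i]
          _ ≤ Real.exp (‖x‖ ^ i) := Real.add_one_le_exp _
    _ = Real.exp (∑ i ∈ Finset.range n, ‖x‖ ^ i) := (Real.exp_sum _ _).symm
    _ ≤ Real.exp (1 - ‖x‖)⁻¹ := by
        rw [← tsum_geometric_of_lt_one (norm_nonneg _) hx]
        gcongr
        exact (summable_geometric_of_lt_one (norm_nonneg _) hx).sum_le_tsum _ (by intros; positivity)

theorem norm_pow_mul_prod_one_sub_pow_le {x : ℂ} (hx : ‖x‖ < 1) (k n : ℕ) :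
    ‖x ^ ((k + 1) * n) * ∏ i ∈ Finset.range (n + 1), (1 - x ^ (k + i + 1))‖ ≤
      ‖x‖ ^ n * Real.exp (1 - ‖x‖)⁻¹ := by
  rw [norm_mul, norm_pow]
  exact mul_le_mul (pow_le_pow_of_le_one (norm_nonneg _) hx.le (by nlinarith))
    (norm_prod_one_sub_pow_le hx k (n + 1)) (norm_nonneg _) (by positivity)

/-- **Pentagonal number theorem** for a complex number in the open unit disc. -/
theorem Complex.tprod_one_sub_pow_eq_tsum_pentagonal {x : ℂ} (hx : ‖x‖ < 1) :
    ∏' n : ℕ, (1 - x ^ (n + 1)) =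
      ∑' k : ℕ, (-1) ^ k * (x ^ pentagonal (-k) - x ^ pentagonal (k + 1)) := by
  have hgeom := summable_geometric_of_lt_one (norm_nonneg _) hx
  have hpow {m n : ℕ} (h : m ≤ n) : ‖x‖ ^ n ≤ ‖x‖ ^ m :=
    pow_le_pow_of_le_one (norm_nonneg _) hx.le h
  refine Pentagonal.tprod_one_sub_pow (tendsto_pow_atTop_nhds_zero_of_norm_lt_one hx)
    (fun k ↦ (hgeom.mul_right _).of_norm_bounded (norm_pow_mul_prod_one_sub_pow_le hx k))
    (fun k ↦ ?_) ?_ ?_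
  · simp only [sub_eq_add_neg]
    refine multipliable_one_add_of_summable (hgeom.of_nonneg_of_le (fun _ ↦ norm_nonneg _) ?_)
    intro n
    rw [norm_neg, norm_pow]
    exact hpow (by lia)
  · refine (hgeom.mul_left 2).of_norm_bounded fun k ↦ ?_
    have h1 : k ≤ pentagonal (-k) := by
      have := two_mul_natCast_pentagonal_neg k
      zify
      nlinarith
    have h2 : k ≤ pentagonal (k + 1) := by
      have := two_mul_natCast_pentagonal (k + 1)
      zify
      nlinarith
    have := norm_sub_le (x ^ pentagonal (-k)) (x ^ pentagonal (k + 1))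
    rw [norm_pow, norm_pow] at this
    simp only [norm_mul, norm_pow, norm_neg, norm_one, one_pow, one_mul]
    linarith [hpow h1, hpow h2]
  · refine squeeze_zero_norm (a := fun k ↦ ‖x‖ ^ k * ∑' n, ‖x‖ ^ n * Real.exp (1 - ‖x‖)⁻¹)
      (fun k ↦ ?_) ?_
    · simp only [norm_mul, norm_pow, norm_neg, norm_one, one_pow, one_mul]
      exact mul_le_mul (hpow ((Nat.le_div_iff_mul_le two_pos).2 (by nlinarith)))
        (tsum_of_norm_bounded (hgeom.mul_right _).hasSum (norm_pow_mul_prod_one_sub_pow_le hx k))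
        (norm_nonneg _) (by positivity)
    · simpa using (tendsto_pow_atTop_nhds_zero_of_lt_one (norm_nonneg _) hx).mul_const
        (∑' n, ‖x‖ ^ n * Real.exp (1 - ‖x‖)⁻¹)

theorem summable_cexp_sq {τ : ℂ} (hτ : 0 < τ.im) :
    Summable fun n : ℤ ↦ cexp (2 * π * I * (n : ℂ) ^ 2 * τ / 12) := by
  have h : 0 < (τ / 6).im := by simpa using hτ
  refine ((summable_jacobiTheta₂_term_iff 0 (τ / 6)).2 h).congr fun n ↦ ?_
  rw [jacobiTheta₂_term]
  ring_nf

theorem summable_negOnePow_mul_cexp {τ : ℂ} (hτ : 0 < τ.im) :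
    Summable fun k : ℤ ↦ (k.negOnePow : ℂ) * cexp (2 * π * I * (6 * k + 1) ^ 2 * τ / 24) := by
  have h := (summable_cexp_sq (τ := τ / 2) (by simpa using hτ)).comp_injective
    (i := fun k : ℤ ↦ 6 * k + 1) (fun a b h ↦ by simpa using h)
  refine h.norm.of_norm_bounded fun k ↦ le_of_eq ?_
  rw [norm_mul]
  rcases Int.even_or_odd k with hk | hk
  · simp [Int.negOnePow_even k hk]; ring_nf
  · simp [Int.negOnePow_odd k hk]; ring_nf

theorem dedekindEta_eq_tsum {τ : ℂ} (hτ : 0 < τ.im) :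
    dedekindEta τ =
      ∑' k : ℤ, (k.negOnePow : ℂ) * cexp (2 * π * I * (6 * k + 1) ^ 2 * τ / 24) := by
  set q := cexp (2 * π * I * τ) with hq
  have hq1 : ‖q‖ < 1 := UpperHalfPlane.norm_exp_two_pi_I_lt_one ⟨τ, hτ⟩
  have hterm (k : ℤ) : cexp (π * I * τ / 12) * q ^ pentagonal (-k) =
      cexp (2 * π * I * (6 * k + 1) ^ 2 * τ / 24) := by
    have h : (2 * pentagonal (-k) : ℂ) = k * (3 * k + 1) := by
      exact_mod_cast two_mul_natCast_pentagonal_neg k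
    rw [hq, ← Complex.exp_nat_mul, ← Complex.exp_add]
    congr 1
    linear_combination π * I * τ * h
  have hprod (n : ℕ) : 1 - cexp (2 * π * I * (n + 1) * τ) = 1 - q ^ (n + 1) := by
    rw [hq, ← Complex.exp_nat_mul]
    push_cast
    ring_nf
  rw [dedekindEta, tprod_congr hprod, Complex.tprod_one_sub_pow_eq_tsum_pentagonal hq1,
    ← tsum_mul_left, ← (summable_negOnePow_mul_cexp hτ).hasSum.nat_add_neg_add_one.tsum_eq]
  refine tsum_congr fun k ↦ ?_
  have h1 := hterm k
  have h2 := hterm (-(k + 1))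
  rw [neg_neg] at h2
  rw [← h1, ← h2, Int.negOnePow_neg, Int.negOnePow_succ]
  simp
  ring

theorem thetaThree_neg (h : ZMod 6) (τ : ℂ) : thetaThree (-h) τ = thetaThree h τ := by
  rw [thetaThree, ← (Equiv.neg ℤ).tsum_eq]
  simp [thetaThree, neg_inj]

theorem summable_thetaThree (h : ZMod 6) {τ : ℂ} (hτ : 0 < τ.im) :
    Summable fun n : ℤ ↦
      if (n : ZMod 6) = h then cexp (2 * π * I * (n : ℂ) ^ 2 * τ / 12) else 0 := by
  classical
  exact ((summable_cexp_sq hτ).indicator {n : ℤ | (n : ZMod 6) = h}).congr fun n ↦ by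
    simp [Set.indicator_apply]

/-- Weber's identity:
`η(τ)² = θ_{3,0}(τ;0)·θ_{3,1}(τ;0) − θ_{3,2}(τ;0)·θ_{3,3}(τ;0)` for `τ` in the upper
half-plane, all series converging absolutely. -/
theorem eta_sq_eq_theta_three_identity (τ : ℂ) (hτ : 0 < τ.im) :
    (∀ h : ZMod 6, (h = 0 ∨ h = 1 ∨ h = 2 ∨ h = 3) → Summable (fun n : ℤ =>
      if (n : ZMod 6) = h then Complex.exp (2 * Real.pi * Complex.I * (n : ℂ) ^ 2 * τ / 12)
      else 0)) ∧
    (dedekindEta τ) ^ 2 =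
      thetaThree 0 τ * thetaThree 1 τ - thetaThree 2 τ * thetaThree 3 τ := by
  refine ⟨fun h _ ↦ summable_thetaThree h hτ, ?_⟩
  have hnorm (h : ZMod 6) := (summable_thetaThree h hτ).norm
  have heta := (summable_negOnePow_mul_cexp hτ).norm
  rw [← thetaThree_neg 2, mul_comm (thetaThree 0 τ), sq, dedekindEta_eq_tsum hτ,
    tsum_mul_tsum_of_summable_norm heta heta]
  unfold thetaThree
  rw [tsum_mul_tsum_of_summable_norm (hnorm 1) (hnorm 0),
    tsum_mul_tsum_of_summable_norm (hnorm (-2)) (hnorm 3),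
    ← (summable_mul_of_summable_norm (hnorm 1) (hnorm 0)).tsum_sub
      (summable_mul_of_summable_norm (hnorm (-2)) (hnorm 3))]
  have hmod (n : ℤ) (r : ℤ) : (n : ZMod 6) = r ↔ n % 6 = r % 6 :=
    ZMod.intCast_eq_intCast_iff n r 6
  have h0 (n : ℤ) : (n : ZMod 6) = 0 ↔ n % 6 = 0 := by simpa using hmod n 0
  have h1 (n : ℤ) : (n : ZMod 6) = 1 ↔ n % 6 = 1 := by simpa using hmod n 1
  have h2 (n : ℤ) : (n : ZMod 6) = -2 ↔ n % 6 = 4 := by simpa using hmod n (-2)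
  have h3 (n : ℤ) : (n : ZMod 6) = 3 ↔ n % 6 = 3 := by simpa using hmod n 3
  simp only [h0, h1, h2, h3]
  let g : ℤ × ℤ → ℤ × ℤ := fun p ↦ (3 * (p.1 + p.2) + 1, 3 * (p.1 - p.2))
  have hg : Function.Injective g := by
    rintro ⟨a, b⟩ ⟨c, d⟩ h
    simp only [g, Prod.mk.injEq] at h ⊢
    lia
  symm
  rw [← hg.tsum_eq]
  · refine tsum_congr fun ⟨a, b⟩ ↦ Eq.symm ?_
    have hexp : cexp (2 * π * I * (6 * a + 1) ^ 2 * τ / 24) *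
        cexp (2 * π * I * (6 * b + 1) ^ 2 * τ / 24) =
        cexp (2 * π * I * ((3 * (a + b) + 1 : ℤ) : ℂ) ^ 2 * τ / 12) *
        cexp (2 * π * I * ((3 * (a - b) : ℤ) : ℂ) ^ 2 * τ / 12) := by
      rw [← Complex.exp_add, ← Complex.exp_add]
      push_cast
      ring_nf
    have hsign : (a.negOnePow : ℂ) * (b.negOnePow : ℂ) = ((a + b).negOnePow : ℂ) := by
      rw [Int.negOnePow_add]
      push_cast
      rfl
    rw [mul_mul_mul_comm, hexp, hsign]
    dsimp only [g]
    rcases Int.even_or_odd (a + b) with hs | hs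
    · rw [Int.negOnePow_even _ hs, if_pos (by grind), if_pos (by grind), if_neg (by grind)]
      simp
    · rw [Int.negOnePow_odd _ hs, if_neg (by grind), if_neg (by grind), if_pos (by grind),
        if_pos (by grind)]
      simp
  · rintro ⟨u, v⟩ h
    have huv : (u % 6 = 1 ∧ v % 6 = 0) ∨ (u % 6 = 4 ∧ v % 6 = 3) := by
      by_contra! hne
      apply h
      grind
    refine ⟨((u - 1 + v) / 6, (u - 1 - v) / 6), ?_⟩
    simp only [g, Prod.mk.injEq]
    lia
end

section
/- Let T and S be the ℂ-linear endomorphisms of ℂ[(ℤ/6ℤ)²] (standard basis 𝔢_{(h₁,h₂)}) given by T(𝔢_{(h₁,h₂)}) = e^{2πi(h₁²+h₂²)/12} 𝔢_{(h₁,h₂)} (well defined since h² mod 12 depends only on h mod 6) and S(𝔢_{(h₁,h₂)}) = (e^{−2πi·2/8}/6) Σ_{(μ₁,μ₂) ∈ (ℤ/6ℤ)²} e^{−2πi(h₁μ₁ + h₂μ₂)/6} 𝔢_{(μ₁,μ₂)}. Then 𝔳₃ := 𝔢_{(0,1)} + 𝔢_{(1,0)} + 𝔢_{(0,−1)} + 𝔢_{(−1,0)}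 − 𝔢_{(3,2)} − 𝔢_{(2,3)} − 𝔢_{(3,−2)} − 𝔢_{(−2,3)} is a common eigenvector: T(𝔳₃) = e^{2πi/12} 𝔳₃ and S(𝔳₃) = e^{−2πi/4} 𝔳₃. In particular the line ℂ·𝔳₃ is invariant under the group generated by T and S (the Weil representation ρ₃ ⊗ ρ₃ attached to the lattice (ℤ², 3x₁² + 3x₂²)). -/
open Complex Real

/-- The action of the generator `T` of `Mp₂(ℤ)` under the Weil representation `ρ₃ ⊗ ρ₃`
attached to the lattice `(ℤ², 3x₁² + 3x₂²)`, on the group ring `ℂ[(ℤ/6ℤ)²]` (realized as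
functions `ZMod 6 × ZMod 6 → ℂ`): `T(𝔢_{(h₁,h₂)}) = e^{2πi(h₁²+h₂²)/12} 𝔢_{(h₁,h₂)}`. -/
noncomputable def weilT33 (f : ZMod 6 × ZMod 6 → ℂ) : ZMod 6 × ZMod 6 → ℂ :=
  fun h =>
    Complex.exp (2 * Real.pi * Complex.I * ((h.1.val : ℂ) ^ 2 + (h.2.val : ℂ) ^ 2) / 12) * f h

/-- The action of the generator `S` of `Mp₂(ℤ)` under the Weil representation `ρ₃ ⊗ ρ₃`
attached to the lattice `(ℤ², 3x₁² + 3x₂²)`: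
`S(𝔢_{(h₁,h₂)}) = (e^{−2πi·2/8}/6) Σ_{(μ₁,μ₂)} e^{−2πi(h₁μ₁ + h₂μ₂)/6} 𝔢_{(μ₁,μ₂)}`. -/
noncomputable def weilS33 (f : ZMod 6 × ZMod 6 → ℂ) : ZMod 6 × ZMod 6 → ℂ :=
  fun μ => Complex.exp (-(2 * Real.pi * Complex.I) * 2 / 8) / 6 *
    ∑ h : ZMod 6 × ZMod 6,
      Complex.exp (-(2 * Real.pi * Complex.I) *
        ((h.1.val : ℂ) * (μ.1.val : ℂ) + (h.2.val : ℂ) * (μ.2.val : ℂ)) / 6) * f h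

/-- The vector
`𝔳₃ = 𝔢_{(0,1)} + 𝔢_{(1,0)} + 𝔢_{(0,−1)} + 𝔢_{(−1,0)} − 𝔢_{(3,2)} − 𝔢_{(2,3)} − 𝔢_{(3,−2)} − 𝔢_{(−2,3)}`
in `ℂ[(ℤ/6ℤ)²]`. -/
noncomputable def frakV3 : ZMod 6 × ZMod 6 → ℂ := fun p =>
  (if p = (0, 1) then 1 else 0) + (if p = (1, 0) then 1 else 0) +
    (if p = (0, -1) then 1 else 0) + (if p = (-1, 0) then 1 else 0) -
    (if p = (3, 2) then 1 else 0) - (if p = (2, 3) then 1 else 0) -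
    (if p = (3, -2) then 1 else 0) - (if p = (-2, 3) then 1 else 0)

/-- `ω = e^{−2πi/6}` is a root of the sixth cyclotomic polynomial `X² − X + 1`. -/
theorem exp_neg_two_pi_I_div_six_sq :
    Complex.exp (-(2 * Real.pi * Complex.I) / 6) ^ 2 =
      Complex.exp (-(2 * Real.pi * Complex.I) / 6) - 1 := by
  have h : Complex.exp (-(2 * Real.pi * Complex.I) / 6) =
      1 / 2 - (Real.sqrt 3 : ℂ) / 2 * Complex.I := by
    rw [show -(2 * Real.pi * Complex.I) / 6 = ((-(Real.pi / 3) : ℝ) : ℂ) * Complex.I by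
      push_cast; ring, Complex.exp_mul_I, ← Complex.ofReal_cos, ← Complex.ofReal_sin,
      Real.cos_neg, Real.sin_neg, Real.cos_pi_div_three, Real.sin_pi_div_three]
    push_cast
    ring
  have h3 : (Real.sqrt 3 : ℂ) ^ 2 = 3 := by
    rw [← Complex.ofReal_pow, Real.sq_sqrt (by norm_num)]
    norm_num
  rw [h]
  linear_combination (Real.sqrt 3 : ℂ) ^ 2 / 4 * Complex.I_sq - h3 / 4

/-- The kernel of `S` as a power of `ω`, with the exponent reduced modulo `6`. -/
theorem exp_neg_two_pi_I_mul_div_six (a b c d : ℕ) :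
    Complex.exp (-(2 * Real.pi * Complex.I) * ((a : ℂ) * b + (c : ℂ) * d) / 6) =
      Complex.exp (-(2 * Real.pi * Complex.I) / 6) ^ ((a * b + c * d) % 6) := by
  have h6 : Complex.exp (-(2 * Real.pi * Complex.I) / 6) ^ 6 = 1 := by
    rw [← Complex.exp_nat_mul, Nat.cast_ofNat, mul_div_cancel₀ _ (by norm_num),
      Complex.exp_neg, Complex.exp_two_pi_mul_I, inv_one]
  rw [← pow_eq_pow_mod _ h6, ← Complex.exp_nat_mul]
  congr 1
  push_cast
  ring

/-- The phase of `T` depends only on `n` modulo `12`. -/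
theorem exp_two_pi_I_mul_div_twelve {n : ℕ} (hn : n % 12 = 1) :
    Complex.exp (2 * Real.pi * Complex.I * n / 12) =
      Complex.exp (2 * Real.pi * Complex.I / 12) := by
  have h12 : Complex.exp (2 * Real.pi * Complex.I / 12) ^ 12 = 1 := by
    rw [← Complex.exp_nat_mul, Nat.cast_ofNat, mul_div_cancel₀ _ (by norm_num),
      Complex.exp_two_pi_mul_I]
  rw [show 2 * Real.pi * Complex.I * n / 12 = n * (2 * Real.pi * Complex.I / 12) by ring,
    Complex.exp_nat_mul, pow_eq_pow_mod _ h12, hn, pow_one]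

/-- `𝔳₃` is supported on the `h` with `Q(h) = 1/12`. -/
theorem frakV3_eq_zero_or (h : ZMod 6 × ZMod 6) :
    frakV3 h = 0 ∨ (h.1.val ^ 2 + h.2.val ^ 2) % 12 = 1 := by
  by_cases hs : h ∈ ({(0, 1), (1, 0), (0, -1), (-1, 0), (3, 2), (2, 3), (3, -2), (-2, 3)} :
      Finset (ZMod 6 × ZMod 6))
  · right
    revert h
    decide
  · left
    simp only [Finset.mem_insert, Finset.mem_singleton, not_or] at hs
    simp [frakV3, hs]

theorem weilT33_frakV3 :
    weilT33 frakV3 = Complex.exp (2 * Real.pi * Complex.I / 12) • frakV3 := by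
  funext h
  rcases frakV3_eq_zero_or h with h0 | h1
  · simp [weilT33, h0]
  · rw [Pi.smul_apply, smul_eq_mul, ← exp_two_pi_I_mul_div_twelve h1]
    push_cast
    rfl

/-- The finite Fourier transform of `𝔳₃` is `6 𝔳₃`. -/
theorem sum_exp_mul_frakV3 (μ : ZMod 6 × ZMod 6) :
    ∑ h : ZMod 6 × ZMod 6,
      Complex.exp (-(2 * Real.pi * Complex.I) *
        ((h.1.val : ℂ) * (μ.1.val : ℂ) + (h.2.val : ℂ) * (μ.2.val : ℂ)) / 6) * frakV3 h =
      6 * frakV3 μ := by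
  have h2 := exp_neg_two_pi_I_div_six_sq
  simp only [exp_neg_two_pi_I_mul_div_six]
  generalize Complex.exp (-(2 * Real.pi * Complex.I) / 6) = w at h2
  have h3 : w ^ 3 = -1 := by linear_combination (w + 1) * h2
  have h4 : w ^ 4 = -w := by linear_combination w * h3
  have h5 : w ^ 5 = 1 - w := by linear_combination w ^ 2 * h3 - h2
  simp only [frakV3, mul_add, mul_sub, Finset.sum_add_distrib, Finset.sum_sub_distrib,
    mul_ite, mul_one, mul_zero, Finset.sum_ite_eq', Finset.mem_univ, if_true]
  obtain ⟨a, b⟩ := μ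
  have v1 : (1 : ZMod 6).val = 1 := rfl
  have v2 : (2 : ZMod 6).val = 2 := rfl
  have v3 : (3 : ZMod 6).val = 3 := rfl
  have v4 : (-2 : ZMod 6).val = 4 := rfl
  have v5 : (-1 : ZMod 6).val = 5 := rfl
  simp only [Prod.mk.injEq, ← (ZMod.val_injective 6).eq_iff, ZMod.val_zero, v1, v2, v3, v4, v5]
  fin_cases a <;> fin_cases b <;>
    simp +decide [ZMod.val, h2, h3, h4, h5] <;> ring

theorem weilS33_frakV3 :
    weilS33 frakV3 = Complex.exp (-(2 * Real.pi * Complex.I) / 4) • frakV3 := by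
  funext μ
  rw [weilS33, sum_exp_mul_frakV3, Pi.smul_apply, smul_eq_mul,
    show -(2 * Real.pi * Complex.I) * 2 / 8 = -(2 * Real.pi * Complex.I) / 4 by ring]
  ring

/-- `𝔳₃` is a common eigenvector of the Weil representation `ρ₃ ⊗ ρ₃`:
`T(𝔳₃) = e^{2πi/12} 𝔳₃` and `S(𝔳₃) = e^{−2πi/4} 𝔳₃`. -/
theorem frakV3_common_eigenvector :
    weilT33 frakV3 = Complex.exp (2 * Real.pi * Complex.I / 12) • frakV3 ∧
    weilS33 frakV3 = Complex.exp (-(2 * Real.pi * Complex.I) / 4) • frakV3 :=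
  ⟨weilT33_frakV3, weilS33_frakV3⟩
end

section
/- (Well-definedness of the character φ on ideals of ℤ[√3].) For every nonzero λ ∈ ℤ[√3] and every unit u of the ring ℤ[√3], one has sgn(uλ) · φ₀(uλ) = sgn(λ) · φ₀(λ), where sgn denotes the sign of the real number obtained via the embedding √3 ↦ +√3. Consequently, sgn(λ)·φ₀(λ) depends only on the ideal (λ) generated by λ. -/
/-- The real embedding of `ℤ[√3]` sending `√3` to the positive square root of `3`. -/
noncomputable def zsqrt3ToReal (l : ℤ√3) : ℝ := l.re + l.im * Real.sqrt 3

open Classical in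
/-- The function `φ₀ : ℤ[√3] → {−1,0,1}`: it is `1` if `λ ≡ 1` or `λ ≡ 2+√3 (mod 2√3)`,
`−1` if `λ ≡ 5` or `λ ≡ 4+√3 (mod 2√3)`, and `0` otherwise. Here `2√3 = ⟨0,2⟩ ∈ ℤ√3`. -/
noncomputable def phi0 (l : ℤ√3) : ℤ :=
  if (⟨0, 2⟩ : ℤ√3) ∣ (l - 1) ∨ (⟨0, 2⟩ : ℤ√3) ∣ (l - ⟨2, 1⟩) then 1
  else if (⟨0, 2⟩ : ℤ√3) ∣ (l - 5) ∨ (⟨0, 2⟩ : ℤ√3) ∣ (l - ⟨4, 1⟩) then -1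
  else 0

lemma zsqrt3ToReal_mul (a b : ℤ√3) :
    zsqrt3ToReal (a * b) = zsqrt3ToReal a * zsqrt3ToReal b := by
  have h : Real.sqrt 3 * Real.sqrt 3 = 3 := Real.mul_self_sqrt (by norm_num)
  simp only [zsqrt3ToReal, Zsqrtd.re_mul, Zsqrtd.im_mul]
  push_cast
  linear_combination (-(a.im : ℝ) * b.im) * h

lemma sign_mul_of_pos_left {c : ℝ} (hc : 0 < c) (x : ℝ) : Real.sign (c * x) = Real.sign x := by
  simp only [Real.sign, mul_pos_iff_of_pos_left hc, mul_neg_iff, hc, hc.not_gt, true_and,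
    false_and, or_false]

lemma two_sqrt_three_dvd_iff (a : ℤ√3) : (⟨0, 2⟩ : ℤ√3) ∣ a ↔ 6 ∣ a.re ∧ 2 ∣ a.im := by
  constructor
  · rintro ⟨c, rfl⟩
    simp only [Zsqrtd.re_mul, Zsqrtd.im_mul]
    omega
  · rintro ⟨⟨m, hm⟩, ⟨n, hn⟩⟩
    exact ⟨⟨n, m⟩, by ext <;> simp <;> omega⟩

lemma phi0_eq (l : ℤ√3) : phi0 l =
    if l.re % 6 = 1 ∧ l.im % 2 = 0 ∨ l.re % 6 = 2 ∧ l.im % 2 = 1 then 1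
    else if l.re % 6 = 5 ∧ l.im % 2 = 0 ∨ l.re % 6 = 4 ∧ l.im % 2 = 1 then -1 else 0 := by
  simp only [phi0, two_sqrt_three_dvd_iff, Zsqrtd.re_sub, Zsqrtd.im_sub, Zsqrtd.re_one,
    Zsqrtd.im_one, Zsqrtd.re_ofNat, Zsqrtd.im_ofNat]
  congr 1
  · apply propext
    omega
  · congr 1
    apply propext
    omega

lemma phi0_neg (l : ℤ√3) : phi0 (-l) = -phi0 l := by
  simp only [phi0_eq, Zsqrtd.re_neg, Zsqrtd.im_neg]
  split_ifs <;> omega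

lemma phi0_two_add_sqrt_three_mul (l : ℤ√3) : phi0 (⟨2, 1⟩ * l) = phi0 l := by
  simp only [phi0_eq, Zsqrtd.re_mul, Zsqrtd.im_mul]
  split_ifs <;> omega

/-- The fundamental solution `2 + √3` of the Pell equation `x² - 3y² = 1`. -/
def pellThree : Pell.Solution₁ 3 := Pell.Solution₁.mk 2 1 (by norm_num)

lemma isFundamental_pellThree : Pell.IsFundamental pellThree :=
  ⟨by simp [pellThree], by simp [pellThree], fun {a} ha => by
    simp only [pellThree, Pell.Solution₁.x_mk]
    omega⟩

lemma norm_eq_one_of_isUnit {u : ℤ√3} (hu : IsUnit u) : u.norm = 1 := by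
  rcases Int.isUnit_iff.mp ((Zsqrtd.isUnit_iff_norm_isUnit u).mp hu) with h | h
  · exact h
  · have h3 : u.re * u.re = 3 * (u.im * u.im) - 1 := by
      rw [Zsqrtd.norm_def] at h
      linarith
    have hmod : u.re * u.re % 3 = 2 := by omega
    have : u.re % 3 = 0 ∨ u.re % 3 = 1 ∨ u.re % 3 = 2 := by omega
    rcases this with h | h | h <;> simp [Int.mul_emod, h] at hmod

/-- The solutions of the Pell equation `x² - 3y² = 1` whose action on `ℤ[√3]` by multiplication
preserves `f`. -/
def pellStabilizer {α : Type*} (f : ℤ√3 → α) : Subgroup (Pell.Solution₁ 3) where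
  carrier := {a | ∀ l : ℤ√3, f (a * l) = f l}
  one_mem' l := congrArg f (one_mul l)
  mul_mem' {a b} ha hb l := by
    have h : ((a * b : Pell.Solution₁ 3) : ℤ√3) = a * b := rfl
    rw [h, mul_assoc, ha, hb]
  inv_mem' {a} ha l := by
    have h : (a : ℤ√3) * (a⁻¹ : Pell.Solution₁ 3) = 1 :=
      congrArg (fun b : Pell.Solution₁ 3 => (b : ℤ√3)) (mul_inv_cancel a)
    rw [← ha, ← mul_assoc, h, one_mul]

lemma sign_mul_phi0_neg (l : ℤ√3) :
    Real.sign (zsqrt3ToReal (-l)) * (phi0 (-l) : ℝ) = Real.sign (zsqrt3ToReal l) * phi0 l := by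
  have h : zsqrt3ToReal (-l) = -zsqrt3ToReal l := by
    simp [zsqrt3ToReal]
    ring
  rw [h, Real.sign_neg, phi0_neg]
  push_cast
  ring

lemma pellThree_mem_pellStabilizer :
    pellThree ∈ pellStabilizer fun l => Real.sign (zsqrt3ToReal l) * (phi0 l : ℝ) := by
  intro l
  have hpos : 0 < zsqrt3ToReal ⟨2, 1⟩ := by
    simp only [zsqrt3ToReal]
    positivity
  have h : (pellThree : ℤ√3) = ⟨2, 1⟩ := rfl
  simp only [h, phi0_two_add_sqrt_three_mul, zsqrt3ToReal_mul]
  rw [sign_mul_of_pos_left hpos]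

/-- Well-definedness of the character `φ` on ideals of `ℤ[√3]`: for every nonzero
`λ ∈ ℤ[√3]` and every unit `u` of `ℤ[√3]`, one has
`sgn(uλ)·φ₀(uλ) = sgn(λ)·φ₀(λ)`, where `sgn` is taken via the embedding `√3 ↦ +√3`. -/
theorem sign_mul_phi0_unit_invariant (l u : ℤ√3) (hl : l ≠ 0) (hu : IsUnit u) :
    Real.sign (zsqrt3ToReal (u * l)) * (phi0 (u * l) : ℝ) =
      Real.sign (zsqrt3ToReal l) * (phi0 l : ℝ) := by
  obtain ⟨a, rfl⟩ : ∃ a : Pell.Solution₁ 3, (a : ℤ√3) = u :=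
    ⟨⟨u, Zsqrtd.norm_eq_one_iff_mem_unitary.mp (norm_eq_one_of_isUnit hu)⟩, rfl⟩
  obtain ⟨n, rfl | rfl⟩ := isFundamental_pellThree.eq_zpow_or_neg_zpow a
  · exact zpow_mem pellThree_mem_pellStabilizer n l
  · have h : ((-pellThree ^ n : Pell.Solution₁ 3) : ℤ√3) =
        -(pellThree ^ n : Pell.Solution₁ 3) := rfl
    rw [h, neg_mul, sign_mul_phi0_neg]
    exact zpow_mem pellThree_mem_pellStabilizer n l
end
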